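/- Let C be a nonempty finite set and consider ℤ^C with the pairing ⟨e_c, e_{c'}⟩ = δ_{c,c'} w(c) for positive integers w(c). Let X ⊆ ℤ^C be the degree-zero subgroup. Then the cokernel Φ of the map X → Hom(X,ℤ) induced by the restricted pairing is finite, of order |Φ| = ∑_{c ∈ C} ∏_{c' ≠ c} w(c'). -/

import Mathlib

open Finset

/-- Gram determinant: diagonal plus constant matrix. -/
lemma gram_det_aux {C : Type*} [Fintype C] [DecidableEq C] (c₀ : C)
    (w : C → ℤ) (hw : ∀ c, 0 < w c) :
    (Matrix.of fun i j : {c // c ≠ c₀} => (if i = j then w i else 0) + w c₀).det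
      = ∑ c, ∏ c' ∈ Finset.univ.erase c, w c' := by
  have hq : ∀ c, (w c : ℚ) ≠ 0 := fun c => by exact_mod_cast (hw c).ne'
  have hA : IsUnit (Matrix.diagonal fun i : {c // c ≠ c₀} => (w i : ℚ)).det := by
    rw [Matrix.det_diagonal, isUnit_iff_ne_zero]
    exact Finset.prod_ne_zero_iff.2 fun i _ => hq i
  have h1 : ((Matrix.of fun i j : {c // c ≠ c₀} =>
      (if i = j then w i else 0) + w c₀).map (Int.castRingHom ℚ)) =
      Matrix.diagonal (fun i : {c // c ≠ c₀} => (w i : ℚ)) +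
        Matrix.replicateCol Unit (fun _ => (w c₀ : ℚ)) *
        Matrix.replicateRow Unit (fun _ => (1 : ℚ)) := by
    ext i j
    simp [Matrix.diagonal_apply, Matrix.mul_apply]
  have h2 : ∀ c, (∏ c' ∈ Finset.univ.erase c, (w c' : ℚ)) = (∏ c', (w c' : ℚ)) * (w c : ℚ)⁻¹ := by
    intro c
    rw [← Finset.mul_prod_erase _ _ (Finset.mem_univ c)]
    field_simp [hq c]
  have hinv : (Matrix.diagonal fun i : {c // c ≠ c₀} => (w i : ℚ))⁻¹ =
      Matrix.diagonal fun i : {c // c ≠ c₀} => (w i : ℚ)⁻¹ := by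
    apply Matrix.inv_eq_right_inv
    rw [Matrix.diagonal_mul_diagonal, ← Matrix.diagonal_one]
    congr 1
    ext i
    exact mul_inv_cancel₀ (hq i)
  have h3 : (((Matrix.of fun i j : {c // c ≠ c₀} =>
      (if i = j then w i else 0) + w c₀).det : ℤ) : ℚ) =
      ((∑ c, ∏ c' ∈ Finset.univ.erase c, w c' : ℤ) : ℚ) := by
    have := RingHom.map_det (Int.castRingHom ℚ) (Matrix.of fun i j : {c // c ≠ c₀} =>
      (if i = j then w i else 0) + w c₀)
    rw [eq_intCast, RingHom.mapMatrix_apply, h1,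
      Matrix.det_add_replicateCol_mul_replicateRow hA, hinv, Matrix.det_diagonal] at this
    rw [this]
    push_cast
    simp only [h2]
    rw [← Finset.mul_sum, Fintype.prod_eq_mul_prod_subtype_ne _ c₀,
      Fintype.sum_eq_add_sum_subtype_ne _ c₀]
    rw [Matrix.det_unique, Matrix.add_apply, Matrix.mul_apply]
    simp only [Matrix.mul_diagonal, Matrix.replicateRow_apply, Matrix.replicateCol_apply,
      Matrix.one_apply_eq, one_mul]
    rw [← Finset.sum_mul]
    field_simp [hq c₀]
  exact_mod_cast h3

/-- The degree-zero lattice is free on the coordinates away from `c₀`. -/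
noncomputable def degZeroEquiv {C : Type*} [Fintype C] [DecidableEq C] (c₀ : C)
    (X : Submodule ℤ (C → ℤ)) (hX : ∀ x : C → ℤ, x ∈ X ↔ ∑ c, x c = 0) :
    X ≃ₗ[ℤ] ({c // c ≠ c₀} → ℤ) where
  toFun x i := (x : C → ℤ) i
  map_add' x y := by ext; simp
  map_smul' x y := by ext; simp
  invFun y := ⟨fun c => if h : c = c₀ then -∑ i, y i else y ⟨c, h⟩, by
    rw [hX, Fintype.sum_eq_add_sum_subtype_ne _ c₀]
    have : ∀ i : {c // c ≠ c₀}, (i : C) ≠ c₀ := fun i => i.2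
    simp [this]⟩
  left_inv x := by
    have h := (hX _).1 x.2
    rw [Fintype.sum_eq_add_sum_subtype_ne _ c₀] at h
    ext c
    by_cases hc : c = c₀
    · subst hc
      simp
      linarith
    · simp [hc]
  right_inv y := by
    ext i
    simp [i.2]

theorem stmt14 (C : Type*) [Fintype C] [Nonempty C] [DecidableEq C]
    (w : C → ℤ) (hw : ∀ c, 0 < w c)
    (X : Submodule ℤ (C → ℤ)) (hX : ∀ x : C → ℤ, x ∈ X ↔ ∑ c, x c = 0)
    (φ : X →ₗ[ℤ] Module.Dual ℤ X)
    (hφ : ∀ x y : X, φ x y = ∑ c, (x : C → ℤ) c * (y : C → ℤ) c * w c) :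
    Finite (Module.Dual ℤ X ⧸ LinearMap.range φ) ∧
      (Nat.card (Module.Dual ℤ X ⧸ LinearMap.range φ) : ℤ)
        = ∑ c, ∏ c' ∈ Finset.univ.erase c, w c' := by
  obtain ⟨c₀⟩ := ‹Nonempty C›
  have hpos : 0 < ∑ c, ∏ c' ∈ Finset.univ.erase c, w c' :=
    Finset.sum_pos (fun c _ => Finset.prod_pos fun c' _ => hw c') ⟨c₀, Finset.mem_univ _⟩
  have hinj : Function.Injective φ := by
    rw [← LinearMap.ker_eq_bot, LinearMap.ker_eq_bot']
    intro x hx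
    have h := hφ x x
    rw [hx, LinearMap.zero_apply, eq_comm, Finset.sum_eq_zero_iff_of_nonneg
      (fun c _ => mul_nonneg (mul_self_nonneg _) (hw c).le)] at h
    ext c
    have := h c (Finset.mem_univ c)
    simpa [(hw c).ne'] using this
  let b : Module.Basis {c // c ≠ c₀} ℤ X := Module.Basis.ofEquivFun (degZeroEquiv c₀ X hX)
  have hb : ∀ i c, (b i : C → ℤ) c = if c = c₀ then -1 else if c = i then 1 else 0 := by
    intro i c
    by_cases hc : c = c₀
    · simp [b, degZeroEquiv, hc]
    · simp [b, degZeroEquiv, hc, Pi.single_apply, Subtype.ext_iff]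
  let bN : Module.Basis {c // c ≠ c₀} ℤ (LinearMap.range φ) :=
    b.map (LinearEquiv.ofInjective φ hinj)
  have key := Submodule.natAbs_det_basis_change b.dualBasis (LinearMap.range φ) bN
  have hdet : b.dualBasis.det ((↑) ∘ bN) = ∑ c, ∏ c' ∈ Finset.univ.erase c, w c' := by
    rw [← gram_det_aux c₀ w hw, Module.Basis.det_apply]
    congr 1
    ext i j
    have hne : ∀ i : {c // c ≠ c₀}, (i : C) ≠ c₀ := fun i => i.2
    have : b.dualBasis.toMatrix ((↑) ∘ bN) i j = φ (b j) (b i) := by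
      simp [Module.Basis.toMatrix_apply, bN]
    rw [this, hφ, Fintype.sum_eq_add_sum_subtype_ne _ c₀]
    simp [hb, hne, Subtype.coe_inj]
    ring
  rw [hdet] at key
  have hcard : (Nat.card (Module.Dual ℤ X ⧸ LinearMap.range φ) : ℤ)
        = ∑ c, ∏ c' ∈ Finset.univ.erase c, w c' := by
    rw [← key, Int.natCast_natAbs, abs_of_pos hpos]
  refine ⟨Nat.finite_of_card_ne_zero ?_, hcard⟩
  intro h
  rw [h] at hcard
  simp at hcard
  omega
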